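/- arXiv:2411.12582 — 3 statements merged into one kernel-verified Lean document; each statement's English description precedes it below -/
import Mathlib

section
/- For every integer k ≥ 2 there exists a connected simple graph G with two dominating sets D_s ≠ D_t, each of size k, such that for every integer d ≥ 1 there is no reconfiguration sequence from D_s to D_t under (k−1, d)-Token Jumping in which every configuration is a dominating set of G of size k. (Concretely, the cycle on 3k vertices, which has exactly three pairwise disjoint minimum dominating sets, witnesses this.) -/
/-- A dominating set of a simple graph: every vertex is in the set or adjacent to it. -/
def IsDS {V : Type*} (G : SimpleGraph V) (S : Finset V) : Prop :=
  ∀ v : V, v ∈ S ∨ ∃ u ∈ S, G.Adj u v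

/-- A `(k', d)`-Token Jumping move from `C` to `C'`: a bijection moving each token
by distance at most `d`, with at most `k'` tokens actually moving. -/
def TJMove {V : Type*} (G : SimpleGraph V) (k' d : ℕ) (C C' : Finset V) : Prop :=
  ∃ f : V → V, Set.BijOn f ↑C ↑C' ∧ (∀ v ∈ C, G.dist v (f v) ≤ d) ∧
    {v | v ∈ C ∧ f v ≠ v}.ncard ≤ k'

open SimpleGraph

open scoped Fin.CommRing

/-- The vertices of `Fin (3 * k)` congruent to `r` modulo `3`. -/
def residueClass (k : ℕ) (r : Fin 3) : Finset (Fin (3 * k)) :=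
  Finset.univ.image fun j : Fin k => ⟨3 * j + r, by omega⟩

theorem mem_residueClass {k : ℕ} {r : Fin 3} {v : Fin (3 * k)} :
    v ∈ residueClass k r ↔ v.val % 3 = r := by
  simp only [residueClass, Finset.mem_image, Finset.mem_univ, true_and, Fin.ext_iff]
  constructor
  · rintro ⟨j, hj⟩
    omega
  · intro h
    exact ⟨⟨v.val / 3, by omega⟩, by simp only; omega⟩

theorem card_residueClass (k : ℕ) (r : Fin 3) : (residueClass k r).card = k := by
  rw [residueClass, Finset.card_image_of_injective, Finset.card_univ, Fintype.card_fin]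
  intro i j h
  simp only [Fin.mk.injEq] at h
  omega

theorem cycleGraph_adj_iff_add_one {n : ℕ} (u v : Fin (n + 2)) :
    (cycleGraph (n + 2)).Adj u v ↔ u = v + 1 ∨ v = u + 1 := by
  rw [cycleGraph_adj, sub_eq_iff_eq_add, sub_eq_iff_eq_add, add_comm 1 v, add_comm 1 u]

/-- A dominating set of a cycle meets every three consecutive vertices. -/
theorem isDS_cycleGraph_iff {n : ℕ} (D : Finset (Fin (n + 2))) :
    IsDS (cycleGraph (n + 2)) D ↔ ∀ v, v ∈ D ∨ v + 1 ∈ D ∨ v + 1 + 1 ∈ D := by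
  have key (v : Fin (n + 2)) :
      (v + 1 ∈ D ∨ ∃ u ∈ D, (cycleGraph (n + 2)).Adj u (v + 1)) ↔
        (v ∈ D ∨ v + 1 ∈ D ∨ v + 1 + 1 ∈ D) := by
    constructor
    · rintro (h | ⟨u, hu, h⟩)
      · exact Or.inr (Or.inl h)
      · rcases (cycleGraph_adj_iff_add_one _ _).1 h with h | h
        · exact Or.inr (Or.inr (h ▸ hu))
        · exact Or.inl (add_right_cancel h ▸ hu)
    · rintro (h | h | h)
      · exact Or.inr ⟨v, h, (cycleGraph_adj_iff_add_one _ _).2 (Or.inr rfl)⟩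
      · exact Or.inl h
      · exact Or.inr ⟨_, h, (cycleGraph_adj_iff_add_one _ _).2 (Or.inl rfl)⟩
  constructor
  · exact fun h v => (key v).1 (h (v + 1))
  · intro h v
    have := (key (v - 1)).2 (h (v - 1))
    rwa [sub_add_cancel] at this

/-- A dominating set of a cycle whose size is a third of the length is perfect, hence invariant
under rotation by three. -/
theorem IsDS.add_three_mem {n : ℕ} {D : Finset (Fin (n + 2))}
    (hD : IsDS (cycleGraph (n + 2)) D) (hcard : D.card * 3 = n + 2)
    {v : Fin (n + 2)} (hv : v ∈ D) : v + 1 + 1 + 1 ∈ D := by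
  rw [isDS_cycleGraph_iff] at hD
  let g : D × Fin 3 → Fin (n + 2) := fun p => ![p.1.1, p.1.1 - 1, p.1.1 - 1 - 1] p.2
  have hsurj : Function.Surjective g := by
    intro w
    rcases hD w with h | h | h
    · exact ⟨(⟨_, h⟩, 0), rfl⟩
    · exact ⟨(⟨_, h⟩, 1), by simp [g]⟩
    · exact ⟨(⟨_, h⟩, 2), by simp [g]⟩
  have hinj : Function.Injective g :=
    ((Fintype.bijective_iff_surjective_and_card g).2 ⟨hsurj, by simp [hcard]⟩).1
  have h1 : v + 1 ∉ D := fun h => by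
    have := @hinj (⟨v, hv⟩, 0) (⟨_, h⟩, 1) (by simp [g])
    simp at this
  have h2 : v + 1 + 1 ∉ D := fun h => by
    have := @hinj (⟨v, hv⟩, 0) (⟨_, h⟩, 2) (by simp [g])
    simp at this
  rcases hD (v + 1) with h | h | h
  · exact absurd h h1
  · exact absurd h h2
  · exact h

theorem isDS_residueClass {k n : ℕ} (hn : 3 * k = n + 2) (r : Fin 3) :
    IsDS (cycleGraph (3 * k)) (residueClass k r) := by
  have hdvd : ∀ D : Finset (Fin (n + 2)), (∀ v, v ∈ D ↔ v.val % 3 = r) →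
      IsDS (cycleGraph (n + 2)) D := by
    intro D hD
    rw [isDS_cycleGraph_iff]
    intro v
    simp only [hD, Fin.val_add, Fin.val_one]
    have hmod (a : ℕ) : a % (n + 2) % 3 = a % 3 := Nat.mod_mod_of_dvd _ ⟨k, hn.symm⟩
    simp only [hmod, Nat.mod_add_mod]
    omega
  have hmem : ∀ v, v ∈ residueClass k r ↔ v.val % 3 = r := fun v => mem_residueClass
  generalize residueClass k r = D at hmem
  revert D
  rw [hn]
  exact hdvd

/-- A minimum dominating set of the cycle of length `3 * k` containing a vertex of a residue class
modulo `3` is that residue class. -/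
theorem IsDS.eq_residueClass {k n : ℕ} (hn : 3 * k = n + 2) {D : Finset (Fin (3 * k))}
    (hD : IsDS (cycleGraph (3 * k)) D) (hcard : D.card = k) {r : Fin 3} {x : Fin (3 * k)}
    (hxD : x ∈ D) (hx : x ∈ residueClass k r) : D = residueClass k r := by
  have hshift : ∀ D : Finset (Fin (n + 2)), D.card = k → IsDS (cycleGraph (n + 2)) D →
      ∀ x ∈ D, ∀ y : Fin (n + 2), x.val % 3 = y.val % 3 → y ∈ D := by
    intro D hcard hD x hx y hxy
    have hiter (t : ℕ) : ((x.val + 3 * t : ℕ) : Fin (n + 2)) ∈ D := by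
      induction t with
      | zero => simpa using hx
      | succ t ih =>
        have h := hD.add_three_mem (by omega) ih
        rw [show x.val + 3 * (t + 1) = x.val + 3 * t + 1 + 1 + 1 by ring]
        simpa only [Nat.cast_add, Nat.cast_one] using h
    have h := hiter ((n + 2 + y.val - x.val) / 3)
    rw [show x.val + 3 * ((n + 2 + y.val - x.val) / 3) = n + 2 + y.val by omega] at h
    simpa using h
  have hclosed : ∀ y : Fin (3 * k), x.val % 3 = y.val % 3 → y ∈ D := by
    clear hx
    revert D x
    rw [hn]
    exact fun hD hcard x hx => hshift _ hcard hD x hx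
  symm
  refine Finset.eq_of_subset_of_card_le (fun y hy => hclosed y ?_) ?_
  · rw [mem_residueClass.1 hx, mem_residueClass.1 hy]
  · rw [hcard, card_residueClass]

/-- A move that moves fewer tokens than there are keeps some token in place. -/
theorem TJMove.exists_mem_inter {V : Type*} {G : SimpleGraph V} {k' d : ℕ} {C C' : Finset V}
    (h : TJMove G k' d C C') (hk : k' < C.card) : ∃ x ∈ C, x ∈ C' := by
  obtain ⟨f, hf, -, hcard⟩ := h
  by_contra! hdisj
  have hmoved : {v | v ∈ C ∧ f v ≠ v} = (C : Set V) := by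
    ext v
    refine ⟨fun hv => hv.1, fun hv => ⟨hv, fun hfv => hdisj v hv ?_⟩⟩
    simpa [hfv] using hf.mapsTo hv
  rw [hmoved, Set.ncard_coe_finset] at hcard
  omega

theorem statement_2 (k : ℕ) (hk : 2 ≤ k) :
    ∃ (n : ℕ) (G : SimpleGraph (Fin n)) (Ds Dt : Finset (Fin n)),
      G.Connected ∧ Ds ≠ Dt ∧ Ds.card = k ∧ Dt.card = k ∧
      IsDS G Ds ∧ IsDS G Dt ∧
      ∀ d : ℕ, 1 ≤ d →
        ¬ ∃ (L : ℕ) (C : ℕ → Finset (Fin n)),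
            C 0 = Ds ∧ C L = Dt ∧
            (∀ i ≤ L, IsDS G (C i) ∧ (C i).card = k) ∧
            (∀ i < L, TJMove G (k - 1) d (C i) (C (i + 1))) := by
  obtain ⟨n, hn⟩ : ∃ n, 3 * k = n + 2 := ⟨3 * k - 2, by omega⟩
  have hne : residueClass k 0 ≠ residueClass k 1 := by
    intro h
    have h0 : (⟨0, by omega⟩ : Fin (3 * k)) ∈ residueClass k 0 := mem_residueClass.2 rfl
    rw [h, mem_residueClass] at h0
    simp at h0
  refine ⟨3 * k, cycleGraph (3 * k), residueClass k 0, residueClass k 1, ?_, hne,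
    card_residueClass k 0, card_residueClass k 1, isDS_residueClass hn 0,
    isDS_residueClass hn 1, ?_⟩
  · rw [hn]
    exact cycleGraph_connected
  · rintro d - ⟨L, C, hstart, hend, hC, hmove⟩
    have hconst : ∀ i ≤ L, C i = residueClass k 0 := by
      intro i
      induction i with
      | zero => exact fun _ => hstart
      | succ i ih =>
        intro hi
        have hCi := ih (by omega)
        obtain ⟨x, hx, hx'⟩ := (hmove i hi).exists_mem_inter (by
          rw [hCi, card_residueClass]
          omega)
        exact (hC _ hi).1.eq_residueClass hn (hC _ hi).2 hx' (hCi ▸ hx)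
    exact hne ((hconst L le_rfl).symm.trans hend)
end

section
/- Let V_s and V_m be finite sets of vertices of a hypergraph H = (V, F) such that there exists an injective map g : V_m → V_s with dist_H(v, g(v)) ≤ 1 for every v ∈ V_m. Then there exists a set of vertices V′ with V_m ⊆ V′ and a bijection f : V_s → V′ such that dist_H(v, f(v)) ≤ 1 for every v ∈ V_s (in particular |V′| = |V_s|). -/
/-- `u` and `v` are at hypergraph distance at most 1: equal or sharing an edge. -/
def hClose {V : Type*} (F : Set (Set V)) (u v : V) : Prop :=
  u = v ∨ ∃ e ∈ F, u ∈ e ∧ v ∈ e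

theorem hClose.symm {V : Type*} {F : Set (Set V)} {u v : V} (h : hClose F u v) :
    hClose F v u := by
  rcases h with rfl | ⟨e, he, hu, hv⟩
  · exact Or.inl rfl
  · exact Or.inr ⟨e, he, hv, hu⟩

/-- The vertices reached by iterating `g` at least once from a point of `B \ A`, staying in `B`
before every application of `g`. -/
inductive ReachedFromDiff {α : Type*} (g : α → α) (A B : Set α) : α → Prop
  | apply {u : α} (hu : u ∈ B) (h : u ∈ A → ReachedFromDiff g A B u) :
      ReachedFromDiff g A B (g u)

/-- If `g` maps `B` injectively into `A`, then there is an injection on `A` whose image covers `B`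
and which either fixes a point or inverts `g` at it. -/
theorem exists_injOn_subset_image_of_injOn {α : Type*} {A B : Set α} {g : α → α}
    (hinj : Set.InjOn g B) (hmap : Set.MapsTo g B A) :
    ∃ f : α → α, Set.InjOn f A ∧ B ⊆ f '' A ∧
      ∀ v, f v = v ∨ (f v ∈ B ∧ g (f v) = v) := by
  classical
  have key : ∀ v, ∃ w, (ReachedFromDiff g A B v →
        w ∈ B ∧ g w = v ∧ (w ∈ A → ReachedFromDiff g A B w)) ∧
      (¬ ReachedFromDiff g A B v → w = v) := by
    intro v
    by_cases hv : ReachedFromDiff g A B v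
    · obtain ⟨hu, h⟩ := hv
      exact ⟨_, fun _ => ⟨hu, rfl, h⟩, fun hn => (hn (.apply hu h)).elim⟩
    · exact ⟨v, fun h => (hv h).elim, fun _ => rfl⟩
  choose f hf hfix using key
  have hinv : ∀ u ∈ B, (u ∈ A → ReachedFromDiff g A B u) → f (g u) = u := fun u hu h =>
    have hw := hf (g u) (.apply hu h)
    hinj hw.1 hu hw.2.1
  refine ⟨f, ?_, ?_, ?_⟩
  · intro v hv w hw hvw
    by_cases h₁ : ReachedFromDiff g A B v <;> by_cases h₂ : ReachedFromDiff g A B w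
    · rw [← (hf v h₁).2.1, ← (hf w h₂).2.1, hvw]
    · have h := (hf v h₁).2.2
      rw [hvw, hfix w h₂] at h
      exact (h₂ (h hw)).elim
    · have h := (hf w h₂).2.2
      rw [← hvw, hfix v h₁] at h
      exact (h₁ (h hv)).elim
    · rw [← hfix v h₁, ← hfix w h₂, hvw]
  · intro u hu
    by_cases h : u ∈ A → ReachedFromDiff g A B u
    · exact ⟨g u, hmap hu, hinv u hu h⟩
    · push Not at h
      exact ⟨u, h.1, hfix u h.2⟩
  · intro v
    by_cases h : ReachedFromDiff g A B v
    · exact Or.inr ⟨(hf v h).1, (hf v h).2.1⟩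
    · exact Or.inl (hfix v h)

theorem statement_7 {V : Type*} (F : Set (Set V)) (Vs Vm : Finset V)
    (g : V → V) (hinj : Set.InjOn g ↑Vm) (hmap : Set.MapsTo g ↑Vm ↑Vs)
    (hg : ∀ v ∈ Vm, hClose F v (g v)) :
    ∃ V' : Finset V, Vm ⊆ V' ∧ V'.card = Vs.card ∧
      ∃ f : V → V, Set.BijOn f ↑Vs ↑V' ∧ ∀ v ∈ Vs, hClose F v (f v) := by
  classical
  obtain ⟨f, hf, hsub, hrel⟩ := exists_injOn_subset_image_of_injOn hinj hmap
  refine ⟨Vs.image f, ?_, Finset.card_image_of_injOn hf, f, ?_, fun v _ => ?_⟩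
  · rw [← Finset.coe_subset, Finset.coe_image]
    exact hsub
  · rw [Finset.coe_image]
    exact hf.bijOn_image
  · rcases hrel v with h | ⟨hm, h⟩
    · exact Or.inl h.symm
    · have hc := (hg (f v) hm).symm
      rwa [h] at hc
end

section
/- Let G be a connected simple graph with n vertices and let I_s and I_t be two independent sets of G, each of size k. Then there exists a sequence I_s = C_0, C_1, …, C_ℓ = I_t with ℓ ≤ n² + 2 such that every C_i is an independent set of G of size exactly k and, for each i, there is a (k,1; 1,3)-Token Jumping move from C_i to C_{i+1} (i.e., all tokens may move by distance at most 1, and at most one token may move by distance at most 3). -/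
/-- An independent set (given as a finset) of a simple graph. -/
def IsIS {V : Type*} (G : SimpleGraph V) (S : Finset V) : Prop :=
  ∀ u ∈ S, ∀ v ∈ S, ¬ G.Adj u v

/-- A `(k,1; k',d)`-Token Jumping move from `C` to `C'`: a bijection for which there is a
subset `D'` of `C` of size at most `k'` whose tokens move by distance at most `d`, while
all other tokens move by distance at most 1. -/
def TJ2Move {V : Type*} (G : SimpleGraph V) (k' d : ℕ) (C C' : Finset V) : Prop :=
  ∃ f : V → V, Set.BijOn f ↑C ↑C' ∧
    ∃ D' : Finset V, D' ⊆ C ∧ D'.card ≤ k' ∧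
      (∀ v ∈ D', G.dist v (f v) ≤ d) ∧
      (∀ v ∈ C, v ∉ D' → G.dist v (f v) ≤ 1)

/-- `StepsWithin r n a b` says that `b` is reached from `a` by at most `n` steps of `r`. -/
inductive StepsWithin {α : Type*} (r : α → α → Prop) : ℕ → α → α → Prop
  | refl (n : ℕ) (a : α) : StepsWithin r n a a
  | head {n : ℕ} {a b c : α} : r a b → StepsWithin r n b c → StepsWithin r (n + 1) a c

namespace StepsWithin

variable {α : Type*} {r : α → α → Prop}

theorem mono {m n : ℕ} {a b : α} (h : StepsWithin r m a b) (hmn : m ≤ n) :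
    StepsWithin r n a b := by
  induction h generalizing n with
  | refl => exact refl _ _
  | head hab _ ih =>
    obtain ⟨n, rfl⟩ : ∃ n', n = n' + 1 := ⟨n - 1, by omega⟩
    exact head hab (ih (by omega))

theorem single {a b : α} (h : r a b) : StepsWithin r 1 a b :=
  head h (refl 0 b)

theorem trans {m n : ℕ} {a b c : α} (hab : StepsWithin r m a b) (hbc : StepsWithin r n b c) :
    StepsWithin r (m + n) a c := by
  induction hab with
  | refl => exact hbc.mono (by omega)
  | head h _ ih => exact (head h (ih hbc)).mono (by omega)

theorem exists_seq {n : ℕ} {a b : α} (h : StepsWithin r n a b) :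
    ∃ L ≤ n, ∃ C : ℕ → α, C 0 = a ∧ C L = b ∧ ∀ i < L, r (C i) (C (i + 1)) := by
  induction h with
  | refl n a => exact ⟨0, by omega, fun _ => a, rfl, rfl, by simp⟩
  | @head n a b c hab _ ih =>
    obtain ⟨L, hL, C, h0, hend, hstep⟩ := ih
    refine ⟨L + 1, by omega, fun i => Nat.casesOn i a C, rfl, hend, ?_⟩
    rintro (_ | i) hi
    · simpa [h0] using hab
    · exact hstep i (by omega)

end StepsWithin

section TokenJumping

variable {V : Type*} {G : SimpleGraph V}

theorem IsIS.mono {S T : Finset V} (hS : IsIS G S) (hTS : T ⊆ S) : IsIS G T :=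
  fun u hu v hv => hS u (hTS hu) v (hTS hv)

theorem TJ2Move.card_eq {k' d : ℕ} {C C' : Finset V} (h : TJ2Move G k' d C C') :
    C'.card = C.card := by
  classical
  obtain ⟨f, hf, -⟩ := h
  have himage : C.image f = C' := by
    apply Finset.coe_injective
    simpa using hf.image_eq
  rw [← himage, Finset.card_image_of_injOn hf.injOn]

theorem TJ2Move.of_bijOn {k' d : ℕ} {C C' : Finset V} {f : V → V}
    (hf : Set.BijOn f ↑C ↑C') (hdist : ∀ v ∈ C, G.dist v (f v) ≤ 1) : TJ2Move G k' d C C' :=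
  ⟨f, hf, ∅, by simp, by simp, by simp, fun v hv _ => hdist v hv⟩

theorem TJ2Move.of_bijOn_symm {k' d : ℕ} {C C' : Finset V} {f : V → V}
    (hf : Set.BijOn f ↑C ↑C') (hdist : ∀ v ∈ C, G.dist v (f v) ≤ 1) : TJ2Move G k' d C' C := by
  rcases isEmpty_or_nonempty V with hV | hV
  · exact ⟨id, by simp [Subsingleton.elim C' C, Set.bijOn_id], ∅, by simp, by simp, by simp,
      fun v => hV.elim v⟩
  refine of_bijOn (hf.symm hf.invOn_invFunOn.symm) fun v hv => ?_
  obtain ⟨u, hu, rfl⟩ := hf.surjOn hv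
  rw [hf.invOn_invFunOn.1 hu, SimpleGraph.dist_comm]
  exact hdist u hu

/-- A single token may jump from `u` to an unoccupied vertex `b`. -/
theorem TJ2Move.insert_erase [DecidableEq V] {d : ℕ} {T : Finset V} {u b : V} (hu : u ∈ T)
    (hb : b ∉ T) (hd : G.dist u b ≤ d) : TJ2Move G 1 d T (insert b (T.erase u)) := by
  refine ⟨fun x => if x = u then b else x, ⟨?_, ?_, ?_⟩, {u}, by simpa using hu, by simp,
    by simpa using hd, ?_⟩
  · intro x hx
    by_cases hxu : x = u <;> simp_all
  · intro x hx y hy hxy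
    by_cases hxu : x = u <;> by_cases hyu : y = u <;> simp_all
  · intro y hy
    have hy' : y = b ∨ y ≠ u ∧ y ∈ T := by
      simpa [and_comm] using hy
    rcases hy' with rfl | ⟨hyu, hyT⟩
    · exact ⟨u, hu, by simp⟩
    · exact ⟨y, hyT, by simp [hyu]⟩
  · intro v _ hvu
    have hne : v ≠ u := by simpa using hvu
    simp [hne]

/-- A move between independent sets in which one token may jump by distance at most `3`. -/
def TJStep (G : SimpleGraph V) (C D : Finset V) : Prop :=
  IsIS G C ∧ IsIS G D ∧ TJ2Move G 1 3 C D

/-- The graph on `S` joining vertices at distance at most `3` in `G`. -/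
def jumpGraph (G : SimpleGraph V) (S : Finset V) : SimpleGraph V :=
  SimpleGraph.fromRel fun u v => u ∈ S ∧ v ∈ S ∧ G.dist u v ≤ 3

theorem jumpGraph_adj {S : Finset V} {u v : V} :
    (jumpGraph G S).Adj u v ↔ u ≠ v ∧ u ∈ S ∧ v ∈ S ∧ G.dist u v ≤ 3 := by
  simp only [jumpGraph, SimpleGraph.fromRel_adj, G.dist_comm (u := v) (v := u)]
  tauto

theorem jumpGraph_reachable_of_dist_le {S : Finset V} {u v : V} (hu : u ∈ S) (hv : v ∈ S)
    (hd : G.dist u v ≤ 3) : (jumpGraph G S).Reachable u v := by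
  by_cases huv : u = v
  · exact huv ▸ .refl _
  · exact (jumpGraph_adj.2 ⟨huv, hu, hv, hd⟩).reachable

theorem jumpGraph_reachable (hconn : G.Connected) {S : Finset V}
    (hdom : ∀ v, ∃ s ∈ S, G.dist v s ≤ 1) {s t : V} (hs : s ∈ S) (ht : t ∈ S) :
    (jumpGraph G S).Reachable s t := by
  have key : ∀ {a b : V}, G.Walk a b → ∀ s ∈ S, G.dist a s ≤ 1 → ∀ t ∈ S, G.dist b t ≤ 1 →
      (jumpGraph G S).Reachable s t := by
    intro a b p
    induction p with
    | @nil a =>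
      intro s hs hsa t ht hta
      refine jumpGraph_reachable_of_dist_le hs ht ?_
      have := hconn.dist_triangle (u := s) (v := a) (w := t)
      rw [G.dist_comm (u := s) (v := a)] at this
      omega
    | @cons a c b hac p ih =>
      intro s hs hsa t ht htb
      obtain ⟨x, hx, hcx⟩ := hdom c
      refine (jumpGraph_reachable_of_dist_le hs hx ?_).trans (ih x hx hcx t ht htb)
      have h₁ := hconn.dist_triangle (u := s) (v := a) (w := x)
      have h₂ := hconn.dist_triangle (u := a) (v := c) (w := x)
      have h₃ := SimpleGraph.dist_eq_one_iff_adj.2 hac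
      rw [G.dist_comm (u := s) (v := a)] at h₁
      omega
  obtain ⟨p⟩ := hconn.preconnected s t
  exact key p s hs (by simp) t ht (by simp)

/-- Along a walk of jumps inside an independent set `S`, the token on its first vertex can be
exchanged for a token on its unoccupied last vertex. -/
theorem stepsWithin_of_walk [DecidableEq V] {S : Finset V} (hS : IsIS G S) {u b : V}
    (p : (jumpGraph G S).Walk u b) {T : Finset V} (hTS : T ⊆ S) (hu : u ∈ T)
    (hbS : b ∈ S) (hb : b ∉ T) :
    StepsWithin (TJStep G) p.length T (insert b (T.erase u)) := by
  induction p generalizing T with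
  | nil => exact absurd hu hb
  | @cons u v b huv p ih =>
    obtain ⟨hne, huS, hvS, hd⟩ := jumpGraph_adj.1 huv
    have step : ∀ {T : Finset V}, T ⊆ S → u ∈ T → v ∉ T →
        TJStep G T (insert v (T.erase u)) := fun hT huT hvT =>
      ⟨hS.mono hT, hS.mono (Finset.insert_subset hvS ((Finset.erase_subset _ _).trans hT)),
        .insert_erase huT hvT hd⟩
    have hbu : b ≠ u := fun h => hb (h ▸ hu)
    by_cases hv : v ∈ T
    · have hbv : b ≠ v := fun h => hb (h ▸ hv)
      have h₁ := ih hTS hv hbS hb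
      have h₂ := step (T := insert b (T.erase v))
        (Finset.insert_subset hbS ((Finset.erase_subset _ _).trans hTS))
        (by simp [hne, hu]) (by simp [hbv.symm])
      have heq : insert v ((insert b (T.erase v)).erase u) = insert b (T.erase u) := by
        ext x; simp only [Finset.mem_insert, Finset.mem_erase]; grind
      rw [heq] at h₂
      exact h₁.trans (.single h₂)
    · have h₁ := step hTS hu hv
      rw [SimpleGraph.Walk.length_cons]
      by_cases hbv : b = v
      · subst hbv
        exact .head h₁ (.refl _ _)
      refine .head h₁ ?_
      have h₂ := ih (T := insert v (T.erase u))
        (Finset.insert_subset hvS ((Finset.erase_subset _ _).trans hTS)) (by simp) hbS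
        (by simp [hbv, hb])
      have heq : insert b ((insert v (T.erase u)).erase v) = insert b (T.erase u) := by
        ext x; simp only [Finset.mem_insert, Finset.mem_erase]; grind
      rwa [heq] at h₂

theorem stepsWithin_of_subset [Fintype V] [DecidableEq V] (hconn : G.Connected) {S : Finset V}
    (hS : IsIS G S) (hdom : ∀ v, ∃ s ∈ S, G.dist v s ≤ 1) {T T' : Finset V} (hT : T ⊆ S)
    (hT' : T' ⊆ S) (hcard : T.card = T'.card) :
    StepsWithin (TJStep G) ((T \ T').card * Fintype.card V) T T' := by
  induction hd : (T \ T').card generalizing T with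
  | zero =>
    have hsub : T ⊆ T' := by simpa using hd
    obtain rfl := Finset.eq_of_subset_of_card_le hsub hcard.ge
    exact .refl _ _
  | succ d ih =>
    obtain ⟨u, hu⟩ : (T \ T').Nonempty := Finset.card_pos.1 (by omega)
    have hd' : (T' \ T).card = d + 1 := by
      rw [← hd]; exact (Finset.card_sdiff_comm hcard).symm
    obtain ⟨b, hb⟩ : (T' \ T).Nonempty := Finset.card_pos.1 (by omega)
    rw [Finset.mem_sdiff] at hu hb
    obtain ⟨p, hp⟩ := (jumpGraph_reachable hconn hdom (hT hu.1) (hT' hb.1)).exists_isPath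
    have h₁ := (stepsWithin_of_walk hS p hT hu.1 (hT' hb.1) hb.2).mono hp.length_lt.le
    have hbu : b ∉ T.erase u := fun h => hb.2 (Finset.mem_of_mem_erase h)
    have hsdiff : insert b (T.erase u) \ T' = (T \ T').erase u := by
      rw [Finset.insert_sdiff_of_mem _ hb.1, Finset.erase_sdiff_comm]
    have h₂ := ih (T := insert b (T.erase u))
      (Finset.insert_subset (hT' hb.1) ((Finset.erase_subset _ _).trans hT))
      (by rw [Finset.card_insert_of_notMem hbu, Finset.card_erase_add_one hu.1, hcard])
      (by rw [hsdiff, Finset.card_erase_of_mem (Finset.mem_sdiff.2 hu), hd]; omega)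
    exact (h₁.trans h₂).mono (by rw [Nat.succ_mul, Nat.add_comm])

/-- Every independent set is matched into a maximum one by moving each token by at most `1`. -/
theorem exists_bijOn_subset_of_maximum {S I : Finset V} (hS : IsIS G S)
    (hmax : ∀ J : Finset V, IsIS G J → J.card ≤ S.card) (hI : IsIS G I) :
    ∃ f : V → V, ∃ T ⊆ S, Set.BijOn f ↑I ↑T ∧ ∀ v ∈ I, G.dist v (f v) ≤ 1 := by
  classical
  let N : I → Finset V := fun x => S.filter fun s => s = x ∨ G.Adj x s
  have hall : ∀ A : Finset I, A.card ≤ (A.biUnion N).card := by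
    intro A
    let B : Finset V := A.map (Function.Embedding.subtype _)
    have hBI : B ⊆ I := fun x hx => by
      obtain ⟨y, -, rfl⟩ := Finset.mem_map.1 hx
      exact y.2
    have hNS : A.biUnion N ⊆ S := Finset.biUnion_subset.2 fun _ _ => Finset.filter_subset _ _
    have hN : ∀ x ∈ B, ∀ s ∈ S, s = x ∨ G.Adj x s → s ∈ A.biUnion N := by
      intro x hx s hs hxs
      obtain ⟨y, hy, rfl⟩ := Finset.mem_map.1 hx
      exact Finset.mem_biUnion.2 ⟨y, hy, Finset.mem_filter.2 ⟨hs, hxs⟩⟩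
    have hindep : IsIS G (S \ A.biUnion N ∪ B) := by
      intro u hu v hv huv
      rw [Finset.mem_union, Finset.mem_sdiff] at hu hv
      rcases hu with hu | hu <;> rcases hv with hv | hv
      · exact hS u hu.1 v hv.1 huv
      · exact hu.2 (hN v hv u hu.1 (.inr huv.symm))
      · exact hv.2 (hN u hu v hv.1 (.inr huv))
      · exact hI u (hBI hu) v (hBI hv) huv
    have hdisj : Disjoint (S \ A.biUnion N) B := by
      rw [Finset.disjoint_left]
      intro x hx hxB
      rw [Finset.mem_sdiff] at hx
      exact hx.2 (hN x hxB x hx.1 (.inl rfl))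
    have hle := hmax _ hindep
    rw [Finset.card_union_of_disjoint hdisj, Finset.card_map] at hle
    have := Finset.card_sdiff_add_card_eq_card hNS
    omega
  obtain ⟨g, hg, hgN⟩ := (Finset.all_card_le_biUnion_card_iff_exists_injective N).1 hall
  let f : V → V := fun x => if hx : x ∈ I then g ⟨x, hx⟩ else x
  have hf : ∀ x (hx : x ∈ I), f x = g ⟨x, hx⟩ := fun x hx => dif_pos hx
  refine ⟨f, I.image f, ?_, ?_, ?_⟩
  · intro y hy
    obtain ⟨x, hx, rfl⟩ := Finset.mem_image.1 hy
    rw [hf x hx]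
    exact (Finset.mem_filter.1 (hgN ⟨x, hx⟩)).1
  · rw [Finset.coe_image]
    refine Set.InjOn.bijOn_image fun x hx y hy hxy => ?_
    rw [hf x hx, hf y hy] at hxy
    exact congrArg Subtype.val (hg hxy)
  · intro x hx
    rw [hf x hx]
    rcases (Finset.mem_filter.1 (hgN ⟨x, hx⟩)).2 with h | h
    · simp [h]
    · exact (SimpleGraph.dist_eq_one_iff_adj.2 h).le

theorem exists_dist_le_one_of_maximum {S : Finset V}
    (hS : IsIS G S) (hmax : ∀ J : Finset V, IsIS G J → J.card ≤ S.card) (v : V) :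
    ∃ s ∈ S, G.dist v s ≤ 1 := by
  have hv : IsIS G {v} := by simp [IsIS]
  obtain ⟨f, T, hTS, hf, hdist⟩ := exists_bijOn_subset_of_maximum hS hmax hv
  exact ⟨f v, hTS (hf.mapsTo (by simp)), hdist v (by simp)⟩

theorem exists_maximum_isIS [Fintype V] (G : SimpleGraph V) :
    ∃ S : Finset V, IsIS G S ∧ ∀ J : Finset V, IsIS G J → J.card ≤ S.card := by
  classical
  obtain ⟨S, hS, hmax⟩ := Finset.exists_max_image
    ((Finset.univ : Finset (Finset V)).filter (IsIS G)) Finset.card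
    ⟨∅, by simp [IsIS]⟩
  exact ⟨S, (Finset.mem_filter.1 hS).2, fun J hJ => hmax J (by simpa using hJ)⟩

end TokenJumping

theorem statement_13 {V : Type*} [Fintype V] (G : SimpleGraph V) (hconn : G.Connected)
    (k : ℕ) (Is It : Finset V) (hIsI : IsIS G Is) (hItI : IsIS G It)
    (hs : Is.card = k) (ht : It.card = k) :
    ∃ L : ℕ, L ≤ Fintype.card V ^ 2 + 2 ∧
      ∃ C : ℕ → Finset V, C 0 = Is ∧ C L = It ∧
        (∀ i ≤ L, IsIS G (C i) ∧ (C i).card = k) ∧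
        ∀ i < L, TJ2Move G 1 3 (C i) (C (i + 1)) := by
  classical
  obtain ⟨S, hS, hmax⟩ := exists_maximum_isIS G
  obtain ⟨f, T, hTS, hf, hfd⟩ := exists_bijOn_subset_of_maximum hS hmax hIsI
  obtain ⟨g, T', hTS', hg, hgd⟩ := exists_bijOn_subset_of_maximum hS hmax hItI
  have hfirst : TJ2Move G 1 3 Is T := .of_bijOn hf hfd
  have hlast : TJ2Move G 1 3 T' It := .of_bijOn_symm hg hgd
  have hmid := stepsWithin_of_subset hconn hS (exists_dist_le_one_of_maximum hS hmax) hTS hTS'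
    (by rw [hfirst.card_eq, ← hlast.card_eq, hs, ht])
  obtain ⟨L, hL, C, h0, hend, hstep⟩ :=
    (StepsWithin.head (r := TJStep G) ⟨hIsI, hS.mono hTS, hfirst⟩
      (hmid.trans (.single ⟨hS.mono hTS', hItI, hlast⟩))).exists_seq
  refine ⟨L, hL.trans ?_, C, h0, hend, fun i hi => ?_, fun i hi => (hstep i hi).2.2⟩
  · have := Nat.mul_le_mul_right (Fintype.card V) (Finset.card_le_univ (T \ T'))
    rw [sq]
    omega
  · induction i with
    | zero => exact h0 ▸ ⟨hIsI, hs⟩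
    | succ i ih =>
      have h := hstep i (by omega)
      exact ⟨h.2.1, h.2.2.card_eq.trans (ih (by omega)).2⟩
end
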